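/- Let d ≥ 2 and let Π_1 = (M^1, P^1, Q^1) and Π_2 = (M^2, P^2, Q^2) be pairwise disjoint distance-d partition systems for Z_n (each with a fixed choice function) with hd(M^1, M^2) ≥ d−1. Let A = ext(Π_1) ∪ ext(Π_2). Then A is a set of permutations of Z_{n+1} with |A| = |ext(Π_1)| + |ext(Π_2)| and hd(A) ≥ d−1. -/

import Mathlib

/-- Extend a permutation of `Fin n` to a permutation of `Fin (n+1)` fixing the new
last element `n`. -/
def extFix {n : ℕ} (σ : Equiv.Perm (Fin n)) : Equiv.Perm (Fin (n + 1)) :=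
  σ.viaFintypeEmbedding ⟨Fin.castSucc, Fin.castSucc_injective n⟩

/-- The extension `ext_k(σ)` of a permutation `σ` of `Z_n` by position `k`:
it sends `k ↦ n`, `n ↦ σ k`, and `j ↦ σ j` for every other `j < n`. -/
def extPerm {n : ℕ} (σ : Equiv.Perm (Fin n)) (k : Fin n) : Equiv.Perm (Fin (n + 1)) :=
  Equiv.swap (Fin.castSucc (σ k)) (Fin.last n) * extFix σ

/-- A distance-`d` partition system for `Z_n`, together with a fixed choice function
designating a covering position for each covered permutation. -/
structure PartitionSystem (n s d : ℕ) where
  /-- the list `M_1, …, M_{s+1}` of pairwise disjoint sets of permutations -/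
  M : Fin (s + 1) → Finset (Equiv.Perm (Fin n))
  /-- the ordered partition of positions `P_1, …, P_s` -/
  P : Fin s → Finset (Fin n)
  /-- the ordered partition of symbols `Q_1, …, Q_s` -/
  Q : Fin s → Finset (Fin n)
  M_disjoint : ∀ i j, i ≠ j → Disjoint (M i) (M j)
  P_disjoint : ∀ i j, i ≠ j → Disjoint (P i) (P j)
  P_cover : ∀ x : Fin n, ∃ i, x ∈ P i
  Q_disjoint : ∀ i j, i ≠ j → Disjoint (Q i) (Q j)
  Q_cover : ∀ x : Fin n, ∃ i, x ∈ Q i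
  /-- Property (I): `hd(M_i) ≥ d` -/
  hd_intra : ∀ i, ∀ σ ∈ M i, ∀ τ ∈ M i, σ ≠ τ → d ≤ hammingDist ⇑σ ⇑τ
  /-- Property (II): `hd(M_i, M_j) ≥ d − 1` for `i ≠ j` -/
  hd_inter : ∀ i j, i ≠ j → ∀ σ ∈ M i, ∀ τ ∈ M j, d - 1 ≤ hammingDist ⇑σ ⇑τ
  /-- the choice function designating a covering position for each covered permutation -/
  choice : Fin s → Equiv.Perm (Fin n) → Fin n
  choice_spec : ∀ i σ, (∃ p ∈ P i, σ p ∈ Q i) →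
    choice i σ ∈ P i ∧ σ (choice i σ) ∈ Q i

/-- The extended array `ext(Π)`: all `ext_{p_σ}(σ)` for covered `σ ∈ M_i` (`1 ≤ i ≤ s`),
together with the extensions of all `σ ∈ M_{s+1}` by the fixed point `n ↦ n`. -/
def extSet {n s d : ℕ} (Ps : PartitionSystem n s d) :
    Finset (Equiv.Perm (Fin (n + 1))) :=
  ((Finset.univ : Finset (Fin s)).biUnion fun i =>
    ((Ps.M i.castSucc).filter fun σ => ∃ p ∈ Ps.P i, σ p ∈ Ps.Q i).image
      fun σ => extPerm σ (Ps.choice i σ))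
  ∪ (Ps.M (Fin.last s)).image extFix

/-- `σ'` arises from `σ` by inserting the symbol `n`: wherever `σ'` disagrees with `σ`, it takes
the value `n`, and the displaced symbol is the value of `σ'` at position `n`. -/
def IsExtension {n : ℕ} (σ' : Equiv.Perm (Fin (n + 1))) (σ : Equiv.Perm (Fin n)) : Prop :=
  ∀ j : Fin n, σ' j.castSucc = (σ j).castSucc ∨
    (σ' j.castSucc = Fin.last n ∧ σ' (Fin.last n) = (σ j).castSucc)

theorem extFix_castSucc {n : ℕ} (σ : Equiv.Perm (Fin n)) (j : Fin n) :
    extFix σ j.castSucc = (σ j).castSucc :=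
  Equiv.Perm.viaFintypeEmbedding_apply_image σ ⟨Fin.castSucc, Fin.castSucc_injective n⟩ j

theorem extFix_last {n : ℕ} (σ : Equiv.Perm (Fin n)) :
    extFix σ (Fin.last n) = Fin.last n := by
  apply Equiv.Perm.viaFintypeEmbedding_apply_notMem_range
  rintro ⟨j, hj⟩
  exact Fin.castSucc_ne_last j hj

theorem isExtension_extFix {n : ℕ} (σ : Equiv.Perm (Fin n)) : IsExtension (extFix σ) σ :=
  fun j => Or.inl (extFix_castSucc σ j)

theorem isExtension_extPerm {n : ℕ} (σ : Equiv.Perm (Fin n)) (k : Fin n) :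
    IsExtension (extPerm σ k) σ := by
  intro j
  by_cases hjk : j = k
  · subst hjk
    right
    simp [extPerm, extFix_castSucc, extFix_last]
  · left
    rw [extPerm, Equiv.Perm.mul_apply, extFix_castSucc, Equiv.swap_apply_of_ne_of_ne]
    · simpa using hjk
    · exact Fin.castSucc_ne_last _

/-- Extending two permutations never decreases their Hamming distance. -/
theorem IsExtension.hammingDist_le {n : ℕ} {σ' τ' : Equiv.Perm (Fin (n + 1))}
    {σ τ : Equiv.Perm (Fin n)} (hσ : IsExtension σ' σ) (hτ : IsExtension τ' τ) :
    hammingDist ⇑σ ⇑τ ≤ hammingDist ⇑σ' ⇑τ' := by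
  have key : ∀ j, σ j ≠ τ j → σ' j.castSucc = τ' j.castSucc →
      σ' j.castSucc = Fin.last n ∧ σ' (Fin.last n) ≠ τ' (Fin.last n) := by
    intro j hne heq
    have hne' : (σ j).castSucc ≠ (τ j).castSucc := fun h => hne (Fin.castSucc_injective n h)
    have h₁ := Fin.castSucc_ne_last (σ j)
    have h₂ := Fin.castSucc_ne_last (τ j)
    rcases hσ j with h | ⟨h, h'⟩ <;> rcases hτ j with g | ⟨g, g'⟩ <;> grind
  unfold hammingDist
  apply Finset.card_le_card_of_injOn
    (fun j => if σ' j.castSucc = τ' j.castSucc then Fin.last n else j.castSucc)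
  · intro j hj
    have hne : σ j ≠ τ j := by simpa using hj
    by_cases h : σ' j.castSucc = τ' j.castSucc
    · simpa [h] using (key j hne h).2
    · simp [h]
  · intro i hi j hj hij
    have hi' : σ i ≠ τ i := by simpa using hi
    have hj' : σ j ≠ τ j := by simpa using hj
    have h₁ := Fin.castSucc_ne_last i
    have h₂ := Fin.castSucc_ne_last j
    apply Fin.castSucc_injective n
    by_cases hi₀ : σ' i.castSucc = τ' i.castSucc
    · by_cases hj₀ : σ' j.castSucc = τ' j.castSucc
      · exact σ'.injective ((key i hi' hi₀).1.trans (key j hj' hj₀).1.symm)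
      · simp only [hi₀, hj₀, if_true, if_false] at hij
        exact absurd hij.symm h₂
    · by_cases hj₀ : σ' j.castSucc = τ' j.castSucc
      · simp only [hi₀, hj₀, if_true, if_false] at hij
        exact absurd hij h₁
      · simpa only [hi₀, hj₀, if_false] using hij

namespace PartitionSystem

/-- The extension of `σ` that the `i`-th set of the list contributes to the extended array. -/
def extAt {n s d : ℕ} (Ps : PartitionSystem n s d) (i : Fin (s + 1)) (σ : Equiv.Perm (Fin n)) :
    Equiv.Perm (Fin (n + 1)) :=
  Fin.lastCases (extFix σ) (fun k => extPerm σ (Ps.choice k σ)) i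

theorem isExtension_extAt {n s d : ℕ} (Ps : PartitionSystem n s d) (i : Fin (s + 1))
    (σ : Equiv.Perm (Fin n)) : IsExtension (Ps.extAt i σ) σ := by
  induction i using Fin.lastCases with
  | last => simpa [extAt] using isExtension_extFix σ
  | cast k => simpa [extAt] using isExtension_extPerm σ (Ps.choice k σ)

theorem exists_eq_extAt {n s d : ℕ} (Ps : PartitionSystem n s d) {σ' : Equiv.Perm (Fin (n + 1))}
    (h : σ' ∈ extSet Ps) : ∃ i, ∃ σ ∈ Ps.M i, σ' = Ps.extAt i σ := by
  simp only [extSet, Finset.mem_union, Finset.mem_biUnion, Finset.mem_univ, true_and,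
    Finset.mem_image, Finset.mem_filter] at h
  rcases h with ⟨i, σ, ⟨hσ, -⟩, rfl⟩ | ⟨σ, hσ, rfl⟩
  · exact ⟨i.castSucc, σ, hσ, by simp [extAt]⟩
  · exact ⟨Fin.last s, σ, hσ, by simp [extAt]⟩

theorem le_hammingDist_of_mem_extSet {n s d : ℕ} (Ps : PartitionSystem n s d)
    {σ' τ' : Equiv.Perm (Fin (n + 1))} (hσ' : σ' ∈ extSet Ps) (hτ' : τ' ∈ extSet Ps)
    (hne : σ' ≠ τ') : d - 1 ≤ hammingDist ⇑σ' ⇑τ' := by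
  obtain ⟨i, σ, hσ, rfl⟩ := Ps.exists_eq_extAt hσ'
  obtain ⟨j, τ, hτ, rfl⟩ := Ps.exists_eq_extAt hτ'
  refine le_trans ?_ ((Ps.isExtension_extAt i σ).hammingDist_le (Ps.isExtension_extAt j τ))
  by_cases hij : i = j
  · subst hij
    exact (Nat.sub_le d 1).trans (Ps.hd_intra i σ hσ τ hτ fun h => hne (by rw [h]))
  · exact Ps.hd_inter i j hij σ hσ τ hτ

end PartitionSystem

/-- **Corollary.** Let `d ≥ 2` and let `Π₁, Π₂` be pairwise disjoint distance-`d`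
partition systems for `Z_n` with `hd(M¹, M²) ≥ d−1`. Then `A = ext(Π₁) ∪ ext(Π₂)` is a
set of permutations of `Z_{n+1}` with `|A| = |ext(Π₁)| + |ext(Π₂)|` and `hd(A) ≥ d−1`. -/
theorem iterative_partition_and_extension_size {n s₁ s₂ d : ℕ} (hd2 : 2 ≤ d)
    (Ps₁ : PartitionSystem n s₁ d) (Ps₂ : PartitionSystem n s₂ d)
    (hdisj : ∀ i j, Disjoint (Ps₁.M i) (Ps₂.M j))
    (hcross : ∀ i j, ∀ σ ∈ Ps₁.M i, ∀ τ ∈ Ps₂.M j, d - 1 ≤ hammingDist ⇑σ ⇑τ) :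
    (extSet Ps₁ ∪ extSet Ps₂).card = (extSet Ps₁).card + (extSet Ps₂).card ∧
    (∀ σ' ∈ extSet Ps₁ ∪ extSet Ps₂, ∀ τ' ∈ extSet Ps₁ ∪ extSet Ps₂,
      σ' ≠ τ' → d - 1 ≤ hammingDist ⇑σ' ⇑τ') := by
  have cross : ∀ σ' ∈ extSet Ps₁, ∀ τ' ∈ extSet Ps₂, d - 1 ≤ hammingDist ⇑σ' ⇑τ' := by
    intro σ' hσ' τ' hτ'
    obtain ⟨i, σ, hσ, rfl⟩ := Ps₁.exists_eq_extAt hσ'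
    obtain ⟨j, τ, hτ, rfl⟩ := Ps₂.exists_eq_extAt hτ'
    exact (hcross i j σ hσ τ hτ).trans
      ((Ps₁.isExtension_extAt i σ).hammingDist_le (Ps₂.isExtension_extAt j τ))
  refine ⟨Finset.card_union_of_disjoint (Finset.disjoint_left.mpr fun σ' h₁ h₂ => ?_), ?_⟩
  · have := cross σ' h₁ σ' h₂
    rw [hammingDist_self] at this
    omega
  · intro σ' hσ' τ' hτ' hne
    rcases Finset.mem_union.mp hσ' with hσ' | hσ' <;> rcases Finset.mem_union.mp hτ' with hτ' | hτ'
    · exact Ps₁.le_hammingDist_of_mem_extSet hσ' hτ' hne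
    · exact cross σ' hσ' τ' hτ'
    · rw [hammingDist_comm]
      exact cross τ' hτ' σ' hσ'
    · exact Ps₂.le_hammingDist_of_mem_extSet hσ' hτ' hne
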